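/- For all reals k, l > 0, the Galerkin single-layer self-integral with coincident-node linear weights satisfies: (i/4)·∫₀^l ∫_{−x}^{l−x} H₀⁽¹⁾(k|x'|)·(1 − x/l)·(1 − (x'+x)/l) dx' dx = (iπ/(8k²))·[H₁⁽¹⁾(kl)·𝐇₀(kl) − H₀⁽¹⁾(kl)·𝐇₁(kl)] − (i/(2k²))·H₂⁽¹⁾(kl) + 2/(π k⁴ l²) + (i/(4k²))·Γ₀(kl) + (i/(2 k⁴ l²))·Γ₂(kl). -/

import Mathlib

open MeasureTheory Set Filter Topology Real intervalIntegral

/-- Bessel function of the first kind `J_n(x)` (integral representation). -/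
noncomputable def besselJ (n : ℕ) (x : ℝ) : ℝ :=
  (1 / π) * ∫ τ in (0:ℝ)..π, Real.cos (n * τ - x * Real.sin τ)

/-- Bessel function of the second kind `Y_n(x)` (integral representation). -/
noncomputable def besselY (n : ℕ) (x : ℝ) : ℝ :=
  (1 / π) * (∫ τ in (0:ℝ)..π, Real.sin (x * Real.sin τ - n * τ))
    - (1 / π) * ∫ t in Set.Ioi (0:ℝ),
        (Real.exp (n * t) + (-1 : ℝ) ^ n * Real.exp (-(n * t))) * Real.exp (-x * Real.sinh t)

/-- Hankel function of the first kind `H_n^{(1)}(x) = J_n(x) + i Y_n(x)`. -/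
noncomputable def hankelH1 (n : ℕ) (x : ℝ) : ℂ :=
  (besselJ n x : ℂ) + Complex.I * (besselY n x : ℂ)

/-- Struve function `𝐇₀(x)`. -/
noncomputable def struveH0 (x : ℝ) : ℝ :=
  (2 / π) * ∫ t in (0:ℝ)..1, Real.sin (x * t) / Real.sqrt (1 - t ^ 2)

/-- Struve function `𝐇₁(x)`. -/
noncomputable def struveH1 (x : ℝ) : ℝ :=
  (2 * x / π) * ∫ t in (0:ℝ)..1, Real.sqrt (1 - t ^ 2) * Real.sin (x * t)

/-- Struve function `𝐇₋₁(x) = 2/π − 𝐇₁(x)`. -/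
noncomputable def struveHm1 (x : ℝ) : ℝ := 2 / π - struveH1 x

/-- `𝓘₀(u) = ∫₀^u H₀⁽¹⁾(x) dx`. -/
noncomputable def calI0 (u : ℝ) : ℂ := ∫ x in (0:ℝ)..u, hankelH1 0 x

/-- `Γ₀(σ) = ∫₀^σ 𝓘₀(x) dx`. -/
noncomputable def Gamma0 (σ : ℝ) : ℂ := ∫ x in (0:ℝ)..σ, calI0 x

/-- `Γ₂(σ) = ∫₀^σ x·(x − σ)·𝓘₀(x) dx`. -/
noncomputable def Gamma2 (σ : ℝ) : ℂ := ∫ x in (0:ℝ)..σ, ((x * (x - σ) : ℝ) : ℂ) * calI0 x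

lemma aux_sinh_lb {t : ℝ} (ht : 0 ≤ t) : Real.exp t / 2 - 1 / 2 ≤ Real.sinh t := by
  rw [Real.sinh_eq]
  have : Real.exp (-t) ≤ 1 := Real.exp_le_one_iff.mpr (by linarith)
  linarith

lemma aux_kbound {x : ℝ} (hx : 0 < x) (m : ℕ) :
    ∃ C : ℝ, ∀ t : ℝ, 0 ≤ t → Real.exp (m * t) * Real.exp (-x * Real.sinh t) ≤ C * Real.exp (-t) := by
  refine ⟨Real.exp (x / 2) * ((m+1).factorial / (x / 2) ^ (m+1)), fun t ht => ?_⟩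
  have h1 : Real.exp (-x * Real.sinh t) ≤ Real.exp (x / 2) * Real.exp (-(x / 2 * Real.exp t)) := by
    rw [← Real.exp_add]
    apply Real.exp_le_exp.mpr
    have := mul_le_mul_of_nonneg_left (aux_sinh_lb ht) hx.le
    linarith
  have h2 := Real.pow_div_factorial_le_exp (x / 2 * Real.exp t) (by positivity) (m+1)
  have hy : 0 < x / 2 * Real.exp t := by positivity
  have h3 : Real.exp (-(x / 2 * Real.exp t)) ≤ (m+1).factorial / (x / 2 * Real.exp t) ^ (m+1) := by
    rw [Real.exp_neg, inv_le_comm₀ (Real.exp_pos _) (by positivity), inv_div]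
    exact h2
  calc Real.exp (m * t) * Real.exp (-x * Real.sinh t)
      ≤ Real.exp (m * t) * (Real.exp (x / 2) * ((m+1).factorial / (x / 2 * Real.exp t) ^ (m+1))) := by
        gcongr
        exact h1.trans (by gcongr)
    _ = Real.exp (x / 2) * ((m+1).factorial / (x / 2) ^ (m+1)) * Real.exp (-t) := by
        have e1 : Real.exp (m * t) = Real.exp t ^ m := by rw [← Real.exp_nat_mul]
        rw [e1, Real.exp_neg, mul_pow]
        have := Real.exp_pos t
        field_simp
        rw [pow_succ]

lemma aux_kint {x : ℝ} (hx : 0 < x) (m : ℕ) {g : ℝ → ℝ} (hg : Continuous g)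
    (hb : ∀ t, 0 ≤ t → |g t| ≤ Real.exp (m * t)) :
    IntegrableOn (fun t => g t * Real.exp (-x * Real.sinh t)) (Ioi 0) := by
  obtain ⟨C, hC⟩ := aux_kbound hx m
  have h1 : IntegrableOn (fun t : ℝ => C * Real.exp (-t)) (Ioi 0) := by
    have := (exp_neg_integrableOn_Ioi 0 one_pos).const_mul C
    simp only [neg_mul, one_mul] at this
    exact this
  refine Integrable.mono' h1 ?_ ?_
  · have : Continuous fun t => g t * Real.exp (-x * Real.sinh t) := by
      have := Real.continuous_sinh
      fun_prop
    exact this.aestronglyMeasurable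
  · filter_upwards [ae_restrict_mem measurableSet_Ioi] with t ht
    have ht : (0:ℝ) < t := ht
    rw [norm_mul, Real.norm_eq_abs, Real.norm_eq_abs, abs_of_pos (Real.exp_pos _)]
    exact (mul_le_mul_of_nonneg_right (hb t ht.le) (Real.exp_pos _).le).trans (hC t ht.le)

lemma aux_sinh_le {t : ℝ} (ht : 0 ≤ t) : |Real.sinh t| ≤ Real.exp t := by
  rw [abs_of_nonneg (Real.sinh_nonneg_iff.mpr ht), Real.sinh_eq]
  have := Real.exp_pos t
  have := Real.exp_pos (-t)
  linarith

lemma aux_cosh_le {t : ℝ} (ht : 0 ≤ t) : |Real.cosh t| ≤ Real.exp t := by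
  rw [abs_of_pos (Real.cosh_pos t), Real.cosh_eq]
  have : Real.exp (-t) ≤ Real.exp t := Real.exp_le_exp.mpr (by linarith)
  linarith

lemma aux_kderiv {x₀ : ℝ} (hx : 0 < x₀) (m : ℕ) {g : ℝ → ℝ} (hg : Continuous g)
    (hb : ∀ t, 0 ≤ t → |g t| ≤ Real.exp (m * t)) :
    HasDerivAt (fun x => ∫ t in Ioi (0:ℝ), g t * Real.exp (-x * Real.sinh t))
      (∫ t in Ioi (0:ℝ), (-Real.sinh t * g t) * Real.exp (-x₀ * Real.sinh t)) x₀ := by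
  have hs := Real.continuous_sinh
  have hb' : ∀ t, 0 ≤ t → |Real.sinh t * g t| ≤ Real.exp ((m+1 : ℕ) * t) := by
    intro t ht
    rw [abs_mul]
    calc |Real.sinh t| * |g t| ≤ Real.exp t * Real.exp (m * t) := by
          gcongr
          · exact aux_sinh_le ht
          · exact hb t ht
      _ = _ := by rw [← Real.exp_add]; push_cast; ring_nf
  refine (_root_.hasDerivAt_integral_of_dominated_loc_of_deriv_le
    (F := fun x t => g t * Real.exp (-x * Real.sinh t))
    (F' := fun x t => (-Real.sinh t * g t) * Real.exp (-x * Real.sinh t))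
    (bound := fun t => |Real.sinh t * g t| * Real.exp (-(x₀/2) * Real.sinh t))
    (s := Ioi (x₀ / 2)) (Ioi_mem_nhds (by linarith)) ?_ ?_ ?_ ?_ ?_ ?_).2
  · refine Eventually.of_forall fun x => Continuous.aestronglyMeasurable ?_
    fun_prop
  · exact aux_kint hx m hg hb
  · refine Continuous.aestronglyMeasurable ?_
    fun_prop
  · filter_upwards [ae_restrict_mem measurableSet_Ioi] with t ht x hx
    have ht : (0:ℝ) < t := ht
    have hx : x₀ / 2 < x := hx
    rw [norm_mul, Real.norm_eq_abs, Real.norm_eq_abs, abs_of_pos (Real.exp_pos _), neg_mul, abs_neg]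
    have := (Real.sinh_pos_iff.mpr ht).le
    gcongr
  · refine aux_kint (by linarith) (m+1) (by fun_prop) ?_
    intro t ht
    rw [abs_abs]
    exact hb' t ht
  · refine Eventually.of_forall fun t x _ => ?_
    have h := (((hasDerivAt_id x).neg.mul_const (Real.sinh t)).exp).const_mul (g t)
    refine HasDerivAt.congr_deriv h ?_
    simp; ring

/-- The three exponential integrals. -/
noncomputable def bB0 (x : ℝ) : ℝ := ∫ t in Ioi (0:ℝ), 1 * Real.exp (-x * Real.sinh t)
noncomputable def bB1 (x : ℝ) : ℝ := ∫ t in Ioi (0:ℝ), Real.sinh t * Real.exp (-x * Real.sinh t)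
noncomputable def bBs (x : ℝ) : ℝ := ∫ t in Ioi (0:ℝ), Real.sinh t ^ 2 * Real.exp (-x * Real.sinh t)

lemma bnd1 (t : ℝ) (_ : 0 ≤ t) : |(1:ℝ)| ≤ Real.exp ((0:ℕ) * t) := by simp
lemma bndS (t : ℝ) (ht : 0 ≤ t) : |Real.sinh t| ≤ Real.exp ((1:ℕ) * t) := by
  simpa using aux_sinh_le ht
lemma bndC (t : ℝ) (ht : 0 ≤ t) : |Real.cosh t| ≤ Real.exp ((1:ℕ) * t) := by
  simpa using aux_cosh_le ht
lemma bndS2 (t : ℝ) (ht : 0 ≤ t) : |Real.sinh t ^ 2| ≤ Real.exp ((2:ℕ) * t) := by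
  rw [abs_pow, Real.exp_nat_mul]
  gcongr
  exact aux_sinh_le ht
lemma bndC2 (t : ℝ) (ht : 0 ≤ t) : |Real.cosh t ^ 2| ≤ Real.exp ((2:ℕ) * t) := by
  rw [abs_pow, Real.exp_nat_mul]
  gcongr
  exact aux_cosh_le ht

lemma bB0_deriv {x : ℝ} (hx : 0 < x) : HasDerivAt bB0 (-bB1 x) x := by
  have := aux_kderiv hx 0 (g := fun _ => 1) continuous_const bnd1
  refine HasDerivAt.congr_deriv this ?_
  rw [bB1, ← MeasureTheory.integral_neg]
  congr 1; ext t; ring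

lemma bB1_deriv {x : ℝ} (hx : 0 < x) : HasDerivAt bB1 (-bBs x) x := by
  have := aux_kderiv hx 1 (g := Real.sinh) Real.continuous_sinh bndS
  refine HasDerivAt.congr_deriv this ?_
  rw [bBs, ← MeasureTheory.integral_neg]
  congr 1; ext t; ring

lemma aux_tendsto_K {x : ℝ} (hx : 0 < x) (m : ℕ) {g : ℝ → ℝ}
    (hb : ∀ t, 0 ≤ t → |g t| ≤ Real.exp (m * t)) :
    Tendsto (fun t => g t * Real.exp (-x * Real.sinh t)) atTop (𝓝 0) := by
  obtain ⟨C, hC⟩ := aux_kbound hx m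
  have h1 : Tendsto (fun t : ℝ => C * Real.exp (-t)) atTop (𝓝 0) := by
    simpa using (Real.tendsto_exp_neg_atTop_nhds_zero).const_mul C
  refine squeeze_zero_norm' ?_ h1
  filter_upwards [eventually_ge_atTop 0] with t ht
  rw [norm_mul, Real.norm_eq_abs, Real.norm_eq_abs, abs_of_pos (Real.exp_pos _)]
  exact (mul_le_mul_of_nonneg_right (hb t ht) (Real.exp_pos _).le).trans (hC t ht)

lemma bB_rel {x : ℝ} (hx : 0 < x) : bB1 x - x * bBs x - x * bB0 x = -1 := by
  have hs := Real.continuous_sinh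
  have hc := Real.continuous_cosh
  have i0 := aux_kint hx 0 (g := fun _ => 1) continuous_const bnd1
  have i1 := aux_kint hx 1 (g := Real.sinh) hs bndS
  have i2 := aux_kint hx 2 (g := fun t => Real.sinh t ^ 2) (by fun_prop) bndS2
  have h := integral_Ioi_of_hasDerivAt_of_tendsto (a := 0)
    (f := fun t => Real.cosh t * Real.exp (-x * Real.sinh t))
    (f' := fun t => Real.sinh t * Real.exp (-x * Real.sinh t)
      - x * (Real.sinh t ^ 2 * Real.exp (-x * Real.sinh t)) - x * (1 * Real.exp (-x * Real.sinh t)))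
    (m := 0) (by apply Continuous.continuousWithinAt; fun_prop) ?_ ?_ (aux_tendsto_K hx 1 bndC)
  · rw [MeasureTheory.integral_sub, MeasureTheory.integral_sub, MeasureTheory.integral_const_mul, MeasureTheory.integral_const_mul] at h
    · simpa [bB1, bBs, bB0] using h
    · exact i1
    · exact i2.const_mul x
    · exact i1.sub (i2.const_mul x)
    · exact i0.const_mul x
  · intro t _
    have h := (Real.hasDerivAt_cosh t).mul (((Real.hasDerivAt_sinh t).const_mul (-x)).exp)
    refine HasDerivAt.congr_deriv h ?_
    have := Real.cosh_sq t
    linear_combination (-x * Real.exp (-x * Real.sinh t)) * this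
  · exact (i1.sub (i2.const_mul x)).sub (i0.const_mul x)

lemma bB1_lim : Tendsto (fun x => x * bB1 x) (𝓝[>] 0) (𝓝 1) := by
  have hs := Real.continuous_sinh
  have hc := Real.continuous_cosh
  have key : ∀ x : ℝ, 0 < x → 1 - x ≤ x * bB1 x ∧ x * bB1 x ≤ 1 := by
    intro x hx
    have i1 := aux_kint hx 1 (g := Real.sinh) hs bndS
    have i2 := aux_kint hx 1 (g := Real.cosh) hc bndC
    have ie := aux_kint hx 0 (g := fun t => Real.exp (-|t|)) (by fun_prop) (by
      intro t ht; simp)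
    have h := integral_Ioi_of_hasDerivAt_of_tendsto (a := 0)
      (f := fun t => -(1 * Real.exp (-x * Real.sinh t)))
      (f' := fun t => x * (Real.cosh t * Real.exp (-x * Real.sinh t)))
      (m := -0) (by apply Continuous.continuousWithinAt; fun_prop) (by
        intro t _
        have h := ((((Real.hasDerivAt_sinh t).const_mul (-x)).exp).const_mul 1).neg
        refine HasDerivAt.congr_deriv h ?_
        ring) (i2.const_mul x) (aux_tendsto_K hx 0 bnd1).neg
    rw [MeasureTheory.integral_const_mul] at h
    simp only [Real.sinh_zero, mul_zero, Real.exp_zero, neg_zero, mul_one, sub_neg_eq_add, zero_add] at h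
    have h2 : (∫ t in Ioi (0:ℝ), Real.cosh t * Real.exp (-x * Real.sinh t)) - bB1 x
        = ∫ t in Ioi (0:ℝ), Real.exp (-|t|) * Real.exp (-x * Real.sinh t) := by
      rw [bB1, ← MeasureTheory.integral_sub i2 i1]
      refine setIntegral_congr_fun measurableSet_Ioi fun t ht => ?_
      have ht : (0:ℝ) < t := ht
      rw [abs_of_pos ht, ← Real.cosh_sub_sinh]; ring
    have h3 : 0 ≤ ∫ t in Ioi (0:ℝ), Real.exp (-|t|) * Real.exp (-x * Real.sinh t) :=
      MeasureTheory.integral_nonneg fun t => by positivity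
    have h4 : (∫ t in Ioi (0:ℝ), Real.exp (-|t|) * Real.exp (-x * Real.sinh t)) ≤ 1 := by
      have : (1:ℝ) = ∫ t in Ioi (0:ℝ), Real.exp (-t) := by rw [integral_exp_neg_Ioi]; simp
      rw [this]
      refine setIntegral_mono_on ie ?_ measurableSet_Ioi fun t ht => ?_
      · simpa using exp_neg_integrableOn_Ioi 0 one_pos
      · have ht : (0:ℝ) < t := ht
        rw [abs_of_pos ht]
        refine mul_le_of_le_one_right (Real.exp_pos _).le (Real.exp_le_one_iff.mpr ?_)
        have := mul_pos hx (Real.sinh_pos_iff.mpr ht)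
        linarith
    constructor <;> nlinarith
  have l1 : Tendsto (fun x : ℝ => 1 - x) (𝓝[>] 0) (𝓝 1) := by
    have : Continuous fun x : ℝ => 1 - x := by fun_prop
    simpa using (this.tendsto 0).mono_left nhdsWithin_le_nhds
  refine tendsto_of_tendsto_of_tendsto_of_le_of_le' l1 tendsto_const_nhds ?_ ?_
  · filter_upwards [self_mem_nhdsWithin] with x hx using (key x hx).1
  · filter_upwards [self_mem_nhdsWithin] with x hx using (key x hx).2

lemma bB0_nonneg (x : ℝ) : 0 ≤ bB0 x := MeasureTheory.integral_nonneg fun t => by positivity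

lemma bB0_bound {x : ℝ} (hx : 0 < x) :
    bB0 x ≤ 4 * Real.exp (x / 2) * x ^ (-(1/2) : ℝ) := by
  have i0 := aux_kint hx 0 (g := fun _ => 1) continuous_const bnd1
  have hi := exp_neg_integrableOn_Ioi 0 (b := 1/2) (by norm_num)
  have h1 : bB0 x ≤ ∫ t in Ioi (0:ℝ), (2 * Real.exp (x / 2) * x ^ (-(1/2) : ℝ)) * Real.exp (-(1/2) * t) := by
    refine setIntegral_mono_on i0 (hi.const_mul _) measurableSet_Ioi fun t ht => ?_
    have ht : (0:ℝ) < t := ht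
    have h1 : Real.exp (-x * Real.sinh t) ≤ Real.exp (x / 2) * Real.exp (-(x / 2 * Real.exp t)) := by
      rw [← Real.exp_add]
      apply Real.exp_le_exp.mpr
      have := mul_le_mul_of_nonneg_left (aux_sinh_lb ht.le) hx.le
      linarith
    have h2 : Real.exp (-(x / 2 * Real.exp t)) ≤ 2 * x ^ (-(1/2) : ℝ) * Real.exp (-(1/2) * t) := by
      have e : x ^ (-(1/2) : ℝ) * Real.exp (-(1/2) * t) = (x * Real.exp t) ^ (-(1/2) : ℝ) := by
        rw [Real.mul_rpow hx.le (Real.exp_pos t).le, ← Real.exp_mul, mul_comm t]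
      rw [mul_assoc, e]
      set y := x * Real.exp t with hy
      have hy0 : 0 < y := by positivity
      have : x / 2 * Real.exp t = y / 2 := by rw [hy]; ring
      rw [this, Real.rpow_neg hy0.le, ← Real.sqrt_eq_rpow, Real.exp_neg]
      have hsq : Real.sqrt y ≤ 2 * Real.exp (y / 2) := by
        rw [Real.sqrt_le_left (by positivity)]
        have := Real.add_one_le_exp (y/2)
        nlinarith
      have := Real.sqrt_pos.mpr hy0
      have := Real.exp_pos (y/2)
      rw [inv_le_comm₀ (by positivity) (by positivity), mul_inv, inv_inv]
      linarith
    rw [one_mul]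
    calc _ ≤ _ := h1
      _ ≤ Real.exp (x / 2) * (2 * x ^ (-(1/2) : ℝ) * Real.exp (-(1/2) * t)) := by gcongr
      _ = _ := by ring
  rw [MeasureTheory.integral_const_mul, integral_exp_mul_Ioi (by norm_num)] at h1
  refine h1.trans_eq ?_
  simp; ring

lemma bB0_cont : ContinuousOn bB0 (Ioi 0) := fun _ hx =>
  (bB0_deriv hx).continuousAt.continuousWithinAt

lemma bB0_int {σ : ℝ} (hσ : 0 ≤ σ) : IntervalIntegrable bB0 volume 0 σ := by
  have h1 : IntervalIntegrable (fun x : ℝ => 4 * Real.exp (σ / 2) * x ^ (-(1/2) : ℝ)) volume 0 σ :=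
    (intervalIntegral.intervalIntegrable_rpow' (by norm_num)).const_mul _
  rw [intervalIntegrable_iff_integrableOn_Ioc_of_le hσ] at h1 ⊢
  refine Integrable.mono' h1 ?_ ?_
  · exact (bB0_cont.mono fun x hx => hx.1).aestronglyMeasurable measurableSet_Ioc
  · filter_upwards [ae_restrict_mem measurableSet_Ioc] with x hx
    rw [Real.norm_eq_abs, abs_of_nonneg (bB0_nonneg x)]
    refine (bB0_bound hx.1).trans ?_
    have := hx.1
    have := hx.2
    gcongr

lemma bB0_lim : Tendsto (fun x => x * bB0 x) (𝓝[>] 0) (𝓝 0) := by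
  have l1 : Tendsto (fun x : ℝ => 4 * Real.exp (x / 2) * Real.sqrt x) (𝓝[>] 0) (𝓝 0) := by
    have : Continuous fun x : ℝ => 4 * Real.exp (x / 2) * Real.sqrt x := by fun_prop
    simpa using (this.tendsto 0).mono_left nhdsWithin_le_nhds
  refine tendsto_of_tendsto_of_tendsto_of_le_of_le' tendsto_const_nhds l1 ?_ ?_
  · filter_upwards [self_mem_nhdsWithin] with x hx using mul_nonneg (le_of_lt hx) (bB0_nonneg x)
  · filter_upwards [self_mem_nhdsWithin] with x hx
    have hx : 0 < x := hx
    have := mul_le_mul_of_nonneg_left (bB0_bound hx) hx.le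
    refine this.trans_eq ?_
    rw [Real.rpow_neg hx.le, ← Real.sqrt_eq_rpow]
    have h := Real.mul_self_sqrt hx.le
    have := Real.sqrt_pos.mpr hx
    field_simp
    nlinarith

noncomputable def eE (x τ : ℝ) : ℂ := Complex.exp (Complex.I * ((x * Real.sin τ : ℝ) : ℂ))

/-- Oscillatory integrals with weight `g`. -/
noncomputable def aA (g : ℝ → ℂ) (x : ℝ) : ℂ := ∫ τ in (0:ℝ)..π, g τ * eE x τ

lemma eE_cont (x : ℝ) : Continuous (eE x) := by
  unfold eE; fun_prop

lemma eE_norm (x τ : ℝ) : ‖eE x τ‖ = 1 := by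
  unfold eE; rw [mul_comm, Complex.norm_exp_ofReal_mul_I]

lemma aA_deriv {g : ℝ → ℂ} (hg : Continuous g) (x₀ : ℝ) :
    HasDerivAt (aA g) (Complex.I * aA (fun τ => (Real.sin τ : ℂ) * g τ) x₀) x₀ := by
  have key := (intervalIntegral.hasDerivAt_integral_of_dominated_loc_of_deriv_le
    (μ := volume) (a := 0) (b := π)
    (F := fun x τ => g τ * eE x τ)
    (F' := fun x τ => Complex.I * ((Real.sin τ : ℂ) * g τ * eE x τ))
    (bound := fun τ => ‖g τ‖) (x₀ := x₀)
    (s := univ) univ_mem ?_ ?_ ?_ ?_ ?_ ?_).2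
  · unfold aA
    refine HasDerivAt.congr_deriv key ?_
    rw [intervalIntegral.integral_const_mul]
  · exact Eventually.of_forall fun x => (hg.mul (eE_cont x)).aestronglyMeasurable
  · exact (hg.mul (eE_cont x₀)).intervalIntegrable _ _
  · have := eE_cont x₀
    exact Continuous.aestronglyMeasurable (by fun_prop)
  · refine Eventually.of_forall fun τ _ x _ => ?_
    rw [norm_mul, norm_mul, norm_mul, eE_norm, Complex.norm_I, one_mul, mul_one, Complex.norm_real]
    exact mul_le_of_le_one_left (norm_nonneg _) (Real.abs_sin_le_one τ)
  · exact hg.norm.intervalIntegrable _ _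
  · refine Eventually.of_forall fun τ _ x _ => ?_
    unfold eE
    have h0 : HasDerivAt (fun x : ℝ => ((x * Real.sin τ : ℝ) : ℂ)) ((1 * Real.sin τ : ℝ) : ℂ) x :=
      ((hasDerivAt_id x).mul_const (Real.sin τ)).ofReal_comp
    have h := ((h0.const_mul Complex.I).cexp).const_mul (g τ)
    refine HasDerivAt.congr_deriv h ?_
    push_cast; ring

lemma eE_deriv (x τ : ℝ) :
    HasDerivAt (eE x) (Complex.I * x * (Real.cos τ : ℂ) * eE x τ) τ := by
  have h0 : HasDerivAt (fun τ : ℝ => ((x * Real.sin τ : ℝ) : ℂ)) ((x * Real.cos τ : ℝ) : ℂ) τ :=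
      ((Real.hasDerivAt_sin τ).const_mul x).ofReal_comp
  have h := (h0.const_mul Complex.I).cexp
  unfold eE
  refine HasDerivAt.congr_deriv h ?_
  push_cast; ring

/-- antisymmetric weights integrate to zero -/
lemma aA_anti {g : ℝ → ℂ} (hg : ∀ τ, g (π - τ) = - g τ) (x : ℝ) : aA g x = 0 := by
  have h := intervalIntegral.integral_comp_sub_left (a := 0) (b := π) (fun τ => g τ * eE x τ) π
  have h2 : (∫ τ in (0:ℝ)..π, g (π - τ) * eE x (π - τ)) = - aA g x := by
    unfold aA
    rw [← intervalIntegral.integral_neg]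
    congr 1; ext τ
    rw [hg]; unfold eE; rw [Real.sin_pi_sub]; ring
  rw [h2] at h
  simp only [sub_self, sub_zero] at h
  change -aA g x = aA g x at h
  have : (2:ℂ) * aA g x = 0 := by linear_combination -h
  simpa using this

lemma aA_cong {g h : ℝ → ℂ} (hh : ∀ τ, g τ = h τ) (x : ℝ) : aA g x = aA h x := by
  unfold aA; congr 1; ext τ; rw [hh]

lemma aA_add {g h : ℝ → ℂ} (hg : Continuous g) (hh : Continuous h) (x : ℝ) :
    aA (fun τ => g τ + h τ) x = aA g x + aA h x := by
  unfold aA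
  rw [← intervalIntegral.integral_add]
  · congr 1; ext τ; ring
  · exact (hg.mul (eE_cont x)).intervalIntegrable _ _
  · exact (hh.mul (eE_cont x)).intervalIntegrable _ _

lemma aA_smul {g : ℝ → ℂ} (c : ℂ) (x : ℝ) :
    aA (fun τ => c * g τ) x = c * aA g x := by
  unfold aA
  rw [← intervalIntegral.integral_const_mul]
  congr 1; ext τ; ring

noncomputable def a0 : ℝ → ℂ := aA (fun _ => 1)
noncomputable def as : ℝ → ℂ := aA (fun τ => (Real.sin τ : ℂ))
noncomputable def ass : ℝ → ℂ := aA (fun τ => (Real.sin τ : ℂ) * (Real.sin τ : ℂ))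
noncomputable def acc : ℝ → ℂ := aA (fun τ => (Real.cos τ : ℂ) * (Real.cos τ : ℂ))

lemma a0_deriv (x : ℝ) : HasDerivAt a0 (Complex.I * as x) x := by
  have := aA_deriv (g := fun _ => 1) continuous_const x
  simpa [a0, as] using this

lemma as_deriv (x : ℝ) : HasDerivAt as (Complex.I * ass x) x := by
  exact aA_deriv (g := fun τ => (Real.sin τ : ℂ)) (by fun_prop) x

lemma ass_acc (x : ℝ) : ass x + acc x = a0 x := by
  unfold ass acc a0
  rw [← aA_add (by fun_prop) (by fun_prop)]
  apply aA_cong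
  intro τ
  have := Real.sin_sq_add_cos_sq τ
  rw [← Complex.ofReal_mul, ← Complex.ofReal_mul, ← Complex.ofReal_add, ← sq, ← sq, this]; simp

lemma acc_rel (x : ℝ) : Complex.I * x * acc x - as x = -2 := by
  have h := intervalIntegral.integral_eq_sub_of_hasDerivAt (a := 0) (b := π)
    (f := fun τ => (Real.cos τ : ℂ) * eE x τ)
    (f' := fun τ => (Complex.I * x * ((Real.cos τ : ℂ) * (Real.cos τ : ℂ)) + (-1) * (Real.sin τ : ℂ)) * eE x τ)
    (fun τ _ => by
      have := ((Real.hasDerivAt_cos τ).ofReal_comp).mul (eE_deriv x τ)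
      refine HasDerivAt.congr_deriv this ?_
      push_cast; ring)
    (by
      have := eE_cont x
      exact Continuous.intervalIntegrable (by fun_prop) _ _)
  change aA _ x = _ at h
  rw [aA_add (by fun_prop) (by fun_prop), aA_smul, aA_smul] at h
  simp only [eE, Real.cos_pi, Real.sin_pi, Real.cos_zero, Real.sin_zero, mul_zero, Complex.ofReal_zero, Complex.exp_zero] at h
  change Complex.I * x * acc x + (-1) * as x = _ at h
  rw [sub_eq_add_neg, ← neg_one_mul (as x), h]; norm_num

lemma JY_eq (n : ℕ) (x : ℝ) :
    ((∫ τ in (0:ℝ)..π, Real.cos (n * τ - x * Real.sin τ) : ℝ) : ℂ)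
      + Complex.I * ((∫ τ in (0:ℝ)..π, Real.sin (x * Real.sin τ - n * τ) : ℝ) : ℂ)
    = aA (fun τ => (Real.cos (n * τ) : ℂ) + (-Complex.I) * (Real.sin (n * τ) : ℂ)) x := by
  rw [← intervalIntegral.integral_ofReal, ← intervalIntegral.integral_ofReal,
    ← intervalIntegral.integral_const_mul, ← intervalIntegral.integral_add]
  · unfold aA
    congr 1; ext τ
    unfold eE
    rw [mul_comm Complex.I ((x * Real.sin τ : ℝ) : ℂ), Complex.exp_mul_I, ← Complex.ofReal_cos, ← Complex.ofReal_sin,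
      Real.cos_sub, Real.sin_sub]
    push_cast
    linear_combination ((Complex.sin (n * τ) * Complex.sin (x * Complex.sin τ))) * Complex.I_sq
  · exact Continuous.intervalIntegrable (by fun_prop) _ _
  · exact Continuous.intervalIntegrable (by fun_prop) _ _

lemma aA_sincos (x : ℝ) : aA (fun τ => (Real.cos τ : ℂ)) x = 0 :=
  aA_anti (fun τ => by rw [Real.cos_pi_sub]; simp) x

lemma H0_eq (x : ℝ) : hankelH1 0 x = (1 / π) * (a0 x - 2 * Complex.I * bB0 x) := by
  have h := JY_eq 0 x
  have h0 : aA (fun τ => (Real.cos ((0:ℕ) * τ) : ℂ) + (-Complex.I) * (Real.sin ((0:ℕ) * τ) : ℂ)) x = a0 x :=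
    aA_cong (fun τ => by simp) x
  rw [h0] at h
  have hB : (∫ t in Set.Ioi (0:ℝ),
        (Real.exp ((0:ℕ) * t) + (-1 : ℝ) ^ 0 * Real.exp (-((0:ℕ) * t))) * Real.exp (-x * Real.sinh t))
      = 2 * bB0 x := by
    unfold bB0
    rw [← MeasureTheory.integral_const_mul]
    congr 1; ext t; simp; ring
  unfold hankelH1 besselJ besselY
  rw [hB, ← h]
  push_cast; ring

lemma H1_eq (x : ℝ) : hankelH1 1 x = (1 / π) * (-Complex.I * as x - 2 * Complex.I * bB1 x) := by
  have h := JY_eq 1 x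
  have h0 : aA (fun τ => (Real.cos ((1:ℕ) * τ) : ℂ) + (-Complex.I) * (Real.sin ((1:ℕ) * τ) : ℂ)) x
      = -Complex.I * as x := by
    rw [aA_add (by fun_prop) (by fun_prop), aA_smul]
    simp only [Nat.cast_one, one_mul]
    rw [aA_sincos, zero_add]; rfl
  rw [h0] at h
  have hB : (∫ t in Set.Ioi (0:ℝ),
        (Real.exp ((1:ℕ) * t) + (-1 : ℝ) ^ 1 * Real.exp (-((1:ℕ) * t))) * Real.exp (-x * Real.sinh t))
      = 2 * bB1 x := by
    unfold bB1
    rw [← MeasureTheory.integral_const_mul]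
    congr 1; ext t; rw [Real.sinh_eq]; simp; ring
  unfold hankelH1 besselJ besselY
  rw [hB, ← h]
  push_cast; ring

lemma H2_eq {x : ℝ} (hx : 0 < x) : hankelH1 2 x
    = (1 / π) * (2 * acc x - a0 x - 2 * Complex.I * (2 * bBs x + bB0 x)) := by
  have h := JY_eq 2 x
  have h0 : aA (fun τ => (Real.cos ((2:ℕ) * τ) : ℂ) + (-Complex.I) * (Real.sin ((2:ℕ) * τ) : ℂ)) x
      = 2 * acc x - a0 x := by
    rw [aA_add (by fun_prop) (by fun_prop), aA_smul]
    rw [aA_anti (g := fun τ => (Real.sin ((2:ℕ) * τ) : ℂ))]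
    · unfold acc a0
      rw [sub_eq_add_neg, ← neg_one_mul (aA (fun _ => 1) x), ← aA_smul, ← aA_smul,
        ← aA_add (by fun_prop) (by fun_prop), mul_zero, add_zero]
      apply aA_cong
      intro τ
      push_cast
      rw [Complex.cos_two_mul]; ring
    · intro τ
      have : ((2:ℕ):ℝ) * (π - τ) = 2 * π - (2:ℕ) * τ := by push_cast; ring
      rw [this, Real.sin_two_pi_sub]; simp
  rw [h0] at h
  have hB : (∫ t in Set.Ioi (0:ℝ),
        (Real.exp ((2:ℕ) * t) + (-1 : ℝ) ^ 2 * Real.exp (-((2:ℕ) * t))) * Real.exp (-x * Real.sinh t))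
      = 2 * (2 * bBs x + bB0 x) := by
    have hs := Real.continuous_sinh
    have i0 := aux_kint hx 0 (g := fun _ => 1) continuous_const bnd1
    have i2 := aux_kint hx 2 (g := fun t => Real.sinh t ^ 2) (by fun_prop) bndS2
    unfold bBs bB0
    rw [← MeasureTheory.integral_const_mul, ← MeasureTheory.integral_add (i2.const_mul 2) i0,
      ← MeasureTheory.integral_const_mul]
    congr 1; ext t
    have h1 : Real.exp (((2:ℕ):ℝ) * t) = Real.exp t ^ 2 := by rw [← Real.exp_nat_mul]
    have h2 : Real.exp (-(((2:ℕ):ℝ) * t)) = Real.exp (-t) ^ 2 := by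
      rw [← Real.exp_nat_mul]; ring_nf
    have h3 : Real.exp t * Real.exp (-t) = 1 := by rw [← Real.exp_add]; simp
    rw [h1, h2, Real.sinh_eq]
    linear_combination (2 * Real.exp (-x * ((Real.exp t - Real.exp (-t)) / 2))) * h3
  unfold hankelH1 besselJ besselY
  rw [hB, ← h]
  push_cast; ring

lemma pi_ne : (π : ℂ) ≠ 0 := by exact_mod_cast Real.pi_ne_zero

lemma H2_rel {x : ℝ} (hx : 0 < x) :
    (x : ℂ) * hankelH1 2 x = 2 * hankelH1 1 x - x * hankelH1 0 x := by
  rw [H2_eq hx, H1_eq, H0_eq]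
  have h1 := acc_rel x
  have h2 : (bB1 x : ℂ) - x * bBs x - x * bB0 x = -1 := by exact_mod_cast bB_rel hx
  linear_combination (1 / (π:ℂ)) * (-2 * Complex.I * h1 + 4 * Complex.I * h2
    + 2 * x * acc x * Complex.I_sq)

lemma H0_deriv {x : ℝ} (hx : 0 < x) : HasDerivAt (hankelH1 0) (-hankelH1 1 x) x := by
  have e : hankelH1 0 = fun x => (1 / (π:ℂ)) * (a0 x - 2 * Complex.I * bB0 x) := funext H0_eq
  rw [e, H1_eq]
  have h := ((a0_deriv x).sub (((bB0_deriv hx).ofReal_comp).const_mul (2 * Complex.I))).const_mul (1 / (π:ℂ))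
  refine HasDerivAt.congr_deriv h ?_
  push_cast; ring

lemma H1_deriv {x : ℝ} (hx : 0 < x) :
    HasDerivAt (fun x : ℝ => (x:ℂ) * hankelH1 1 x) (x * hankelH1 0 x) x := by
  have e : (fun x : ℝ => (x:ℂ) * hankelH1 1 x)
    = fun x : ℝ => (x:ℂ) * ((1 / (π:ℂ)) * (-Complex.I * as x - 2 * Complex.I * bB1 x)) := by
      ext x; rw [H1_eq]
  rw [e, H0_eq]
  have h := (hasDerivAt_id x).ofReal_comp.mul ((((as_deriv x).const_mul (-Complex.I)).sub
    (((bB1_deriv hx).ofReal_comp).const_mul (2 * Complex.I))).const_mul (1 / (π:ℂ)))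
  refine HasDerivAt.congr_deriv h ?_
  have h1 := acc_rel x
  have h3 := ass_acc x
  have h2 : (bB1 x : ℂ) - x * bBs x - x * bB0 x = -1 := by exact_mod_cast bB_rel hx
  simp only [id, Pi.sub_apply]
  push_cast
  linear_combination (-1 / (π:ℂ)) * (- Complex.I * h1 + 2 * Complex.I * h2
    + (x * acc x + x * ass x) * Complex.I_sq - x * h3)

lemma ofReal_lim {f : ℝ → ℝ} {F : Filter ℝ} {c : ℝ} (h : Tendsto f F (𝓝 c)) :
    Tendsto (fun x => (f x : ℂ)) F (𝓝 (c : ℂ)) :=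
  (Complex.continuous_ofReal.tendsto c).comp h

lemma H0_lim : Tendsto (fun x : ℝ => (x:ℂ) * hankelH1 0 x) (𝓝[>] 0) (𝓝 0) := by
  have e : (fun x : ℝ => (x:ℂ) * hankelH1 0 x)
    = fun x : ℝ => (1 / (π:ℂ)) * ((x:ℂ) * a0 x - 2 * Complex.I * ((x * bB0 x : ℝ) : ℂ)) := by
      ext x; rw [H0_eq]; push_cast; ring
  rw [e]
  have hc : Continuous a0 := continuous_iff_continuousAt.mpr fun x => (a0_deriv x).continuousAt
  have h1 : Tendsto (fun x : ℝ => (x:ℂ) * a0 x) (𝓝[>] 0) (𝓝 0) := by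
    have : Continuous (fun x : ℝ => (x:ℂ) * a0 x) := by fun_prop
    simpa using (this.tendsto 0).mono_left nhdsWithin_le_nhds
  simpa using (h1.sub ((ofReal_lim bB0_lim).const_mul (2 * Complex.I))).const_mul (1 / (π:ℂ))

lemma as_cont : Continuous as := continuous_iff_continuousAt.mpr fun x => (as_deriv x).continuousAt
lemma a0_cont : Continuous a0 := continuous_iff_continuousAt.mpr fun x => (a0_deriv x).continuousAt

lemma H1_lim : Tendsto (fun x : ℝ => (x:ℂ) * hankelH1 1 x) (𝓝[>] 0) (𝓝 (-2 * Complex.I / π)) := by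
  have e : (fun x : ℝ => (x:ℂ) * hankelH1 1 x)
    = fun x : ℝ => (1 / (π:ℂ)) * (-Complex.I * ((x:ℂ) * as x) - 2 * Complex.I * ((x * bB1 x : ℝ) : ℂ)) := by
      ext x; rw [H1_eq]; push_cast; ring
  rw [e]
  have hc := as_cont
  have h1 : Tendsto (fun x : ℝ => (x:ℂ) * as x) (𝓝[>] 0) (𝓝 0) := by
    have : Continuous (fun x : ℝ => (x:ℂ) * as x) := by fun_prop
    simpa using (this.tendsto 0).mono_left nhdsWithin_le_nhds
  have := ((h1.const_mul (-Complex.I)).sub ((ofReal_lim bB1_lim).const_mul (2 * Complex.I))).const_mul (1 / (π:ℂ))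
  convert this using 2
  push_cast; ring

lemma H0_int {σ : ℝ} (hσ : 0 ≤ σ) : IntervalIntegrable (hankelH1 0) volume 0 σ := by
  have e : hankelH1 0 = fun x => (1 / (π:ℂ)) * (a0 x - 2 * Complex.I * bB0 x) := funext H0_eq
  rw [e]
  refine ((a0_cont.intervalIntegrable _ _).sub (IntervalIntegrable.const_mul ?_ _)).const_mul _
  have := bB0_int hσ
  rw [intervalIntegrable_iff] at this ⊢
  exact this.ofReal

-- Struve functions
lemma half_symm {f : ℝ → ℝ} (hf : Continuous f) :
    (∫ τ in (0:ℝ)..π, f (Real.sin τ)) = 2 * ∫ τ in (0:ℝ)..(π/2), f (Real.sin τ) := by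
  have hc : Continuous fun τ => f (Real.sin τ) := by fun_prop
  rw [← intervalIntegral.integral_add_adjacent_intervals (b := π/2)
    (hc.intervalIntegrable _ _) (hc.intervalIntegrable _ _)]
  have h := intervalIntegral.integral_comp_sub_left (a := 0) (b := π/2) (fun τ => f (Real.sin τ)) π
  simp only [Real.sin_pi_sub] at h
  have e : π - π/2 = π/2 := by ring
  rw [sub_zero, e] at h
  rw [← h]; ring

lemma sin_subst (g : ℝ → ℝ) : (∫ t in (0:ℝ)..1, g t)
    = ∫ τ in (0:ℝ)..(π/2), Real.cos τ * g (Real.sin τ) := by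
  have hpi := Real.pi_pos
  have him : Real.sin '' (Ioo 0 (π/2)) = Ioo 0 1 := by
    ext y
    constructor
    · rintro ⟨t, ht, rfl⟩
      refine ⟨Real.sin_pos_of_pos_of_lt_pi ht.1 (by linarith [ht.2]), ?_⟩
      have := Real.sin_lt_sin_of_lt_of_le_pi_div_two (x := t) (y := π/2) (by linarith [ht.1]) le_rfl ht.2
      simpa using this
    · intro hy
      refine ⟨Real.arcsin y, ⟨Real.arcsin_pos.mpr hy.1, Real.arcsin_lt_pi_div_two.mpr hy.2⟩, ?_⟩
      exact Real.sin_arcsin (by linarith [hy.1]) hy.2.le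
  rw [intervalIntegral.integral_of_le zero_le_one, intervalIntegral.integral_of_le (by positivity),
    integral_Ioc_eq_integral_Ioo, integral_Ioc_eq_integral_Ioo, ← him,
    integral_image_eq_integral_abs_deriv_smul measurableSet_Ioo
      (fun x _ => (Real.hasDerivAt_sin x).hasDerivWithinAt)]
  · refine setIntegral_congr_fun measurableSet_Ioo fun τ hτ => ?_
    simp only [smul_eq_mul]
    rw [abs_of_pos (Real.cos_pos_of_mem_Ioo ⟨by linarith [hτ.1], hτ.2⟩)]
  · exact Real.injOn_sin.mono (fun t (ht : t ∈ Ioo 0 (π/2)) => (⟨by linarith [ht.1], ht.2.le⟩ : t ∈ Icc (-(π/2)) (π/2)))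

lemma cos_sqrt {τ : ℝ} (h : τ ∈ Ioo 0 (π/2)) : Real.sqrt (1 - Real.sin τ ^ 2) = Real.cos τ := by
  have hpi := Real.pi_pos
  rw [← Real.cos_sq']
  exact Real.sqrt_sq (Real.cos_pos_of_mem_Ioo ⟨by linarith [h.1], h.2⟩).le

lemma aA_im {g : ℝ → ℝ} (hg : Continuous g) (x : ℝ) :
    (aA (fun τ => (g τ : ℂ)) x).im = ∫ τ in (0:ℝ)..π, g τ * Real.sin (x * Real.sin τ) := by
  unfold aA
  have hi : IntervalIntegrable (fun τ => (g τ : ℂ) * eE x τ) volume 0 π := by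
    have := eE_cont x
    exact Continuous.intervalIntegrable (by fun_prop) _ _
  have := Complex.imCLM.intervalIntegral_comp_comm hi
  simp only [Complex.imCLM_apply] at this
  rw [← this]
  congr 1; ext τ
  rw [Complex.im_ofReal_mul]
  unfold eE
  rw [mul_comm Complex.I, Complex.exp_ofReal_mul_I_im]

lemma S0_eq (x : ℝ) : struveH0 x = (1 / π) * (a0 x).im := by
  have h := aA_im (g := fun _ => 1) continuous_const x
  simp only [Complex.ofReal_one, one_mul] at h
  unfold struveH0 a0
  rw [h, half_symm (f := fun y => Real.sin (x * y)) (by fun_prop), sin_subst]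
  have : (∫ τ in (0:ℝ)..(π/2), Real.cos τ * (Real.sin (x * Real.sin τ) / Real.sqrt (1 - Real.sin τ ^ 2)))
      = ∫ τ in (0:ℝ)..(π/2), Real.sin (x * Real.sin τ) := by
    have hpi := Real.pi_pos
    rw [intervalIntegral.integral_of_le (by positivity), intervalIntegral.integral_of_le (by positivity),
      integral_Ioc_eq_integral_Ioo, integral_Ioc_eq_integral_Ioo]
    refine setIntegral_congr_fun measurableSet_Ioo fun τ hτ => ?_
    rw [cos_sqrt hτ]
    have := Real.cos_pos_of_mem_Ioo (x := τ) ⟨by linarith [hτ.1], hτ.2⟩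
    field_simp
  rw [this]; ring

lemma S1_eq' (x : ℝ) : struveH1 x = (x / π) * (acc x).im := by
  have h := aA_im (g := fun τ => Real.cos τ * Real.cos τ) (by fun_prop) x
  have h' : (acc x).im = ∫ τ in (0:ℝ)..π, Real.cos τ * Real.cos τ * Real.sin (x * Real.sin τ) := by
    unfold acc
    simp only [← Complex.ofReal_mul]
    exact h
  have h2 : (∫ τ in (0:ℝ)..π, Real.cos τ * Real.cos τ * Real.sin (x * Real.sin τ))
      = ∫ τ in (0:ℝ)..π, (1 - Real.sin τ ^ 2) * Real.sin (x * Real.sin τ) := by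
    congr 1; ext τ; rw [← Real.cos_sq']; ring
  unfold struveH1
  rw [h', h2, half_symm (f := fun y => (1 - y ^ 2) * Real.sin (x * y)) (by fun_prop), sin_subst]
  have : (∫ τ in (0:ℝ)..(π/2), Real.cos τ * (Real.sqrt (1 - Real.sin τ ^ 2) * Real.sin (x * Real.sin τ)))
      = ∫ τ in (0:ℝ)..(π/2), (1 - Real.sin τ ^ 2) * Real.sin (x * Real.sin τ) := by
    have hpi := Real.pi_pos
    rw [intervalIntegral.integral_of_le (by positivity), intervalIntegral.integral_of_le (by positivity),
      integral_Ioc_eq_integral_Ioo, integral_Ioc_eq_integral_Ioo]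
    refine setIntegral_congr_fun measurableSet_Ioo fun τ hτ => ?_
    rw [cos_sqrt hτ, ← Real.cos_sq']
    ring
  rw [this]; ring

lemma S1_eq (x : ℝ) : struveH1 x = (1 / π) * (2 - (as x).re) := by
  rw [S1_eq']
  have h := congrArg Complex.re (acc_rel x)
  simp at h
  have : x * (acc x).im = 2 - (as x).re := by linarith
  rw [← this]; ring

lemma im_deriv {f : ℝ → ℂ} {f' : ℂ} {x : ℝ} (h : HasDerivAt f f' x) :
    HasDerivAt (fun x => (f x).im) f'.im x := by
  exact Complex.imCLM.hasFDerivAt.comp_hasDerivAt x h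

lemma re_deriv {f : ℝ → ℂ} {f' : ℂ} {x : ℝ} (h : HasDerivAt f f' x) :
    HasDerivAt (fun x => (f x).re) f'.re x := by
  exact Complex.reCLM.hasFDerivAt.comp_hasDerivAt x h

lemma S0_deriv (x : ℝ) : HasDerivAt struveH0 (2 / π - struveH1 x) x := by
  rw [funext S0_eq, S1_eq]
  have h := (im_deriv (a0_deriv x)).const_mul (1 / π)
  refine HasDerivAt.congr_deriv h ?_
  simp; ring

lemma S1_deriv (x : ℝ) : HasDerivAt (fun x => x * struveH1 x) (x * struveH0 x) x := by
  have e : (fun x => x * struveH1 x) = fun x => x * ((1 / π) * (2 - (as x).re)) := by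
    ext x; rw [S1_eq]
  rw [e, S0_eq]
  have h := (hasDerivAt_id x).mul (((re_deriv (as_deriv x)).const_sub 2).const_mul (1 / π))
  refine HasDerivAt.congr_deriv h ?_
  have h1 := congrArg Complex.re (acc_rel x)
  simp at h1
  have h2 := congrArg Complex.im (ass_acc x)
  simp at h2
  simp
  rw [← h2]
  linear_combination (π⁻¹) * h1

lemma S0_zero : struveH0 0 = 0 := by simp [struveH0]
lemma S0_cont : Continuous struveH0 := continuous_iff_continuousAt.mpr fun x => (S0_deriv x).continuousAt
lemma S1_cont : Continuous struveH1 := by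
  rw [funext S1_eq]
  have := as_cont
  have : Continuous fun x => (as x).re := Complex.continuous_re.comp as_cont
  fun_prop

noncomputable def mM1 (u : ℝ) : ℂ := ∫ w in (0:ℝ)..u, hankelH1 0 w * (w:ℂ)

lemma wH0_int {σ : ℝ} (hσ : 0 ≤ σ) :
    IntervalIntegrable (fun w : ℝ => hankelH1 0 w * (w:ℂ)) volume 0 σ :=
  (H0_int hσ).mul_continuousOn (by fun_prop)

lemma calI0_cont {σ : ℝ} (hσ : 0 ≤ σ) : ContinuousOn calI0 (Icc 0 σ) := by
  have h := intervalIntegral.continuousOn_primitive_interval (a := 0) (b := σ) (μ := volume)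
    (f := hankelH1 0) (by
      rw [uIcc_of_le hσ]
      exact (intervalIntegrable_iff_integrableOn_Icc_of_le hσ).mp (H0_int hσ))
  rw [uIcc_of_le hσ] at h
  exact h

lemma mM1_cont {σ : ℝ} (hσ : 0 ≤ σ) : ContinuousOn mM1 (Icc 0 σ) := by
  have h := intervalIntegral.continuousOn_primitive_interval (a := 0) (b := σ) (μ := volume)
    (f := fun w : ℝ => hankelH1 0 w * (w:ℂ)) (by
      rw [uIcc_of_le hσ]
      exact (intervalIntegrable_iff_integrableOn_Icc_of_le hσ).mp (wH0_int hσ))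
  rw [uIcc_of_le hσ] at h
  exact h

lemma mM1_eq {v : ℝ} (hv : 0 < v) : mM1 v = v * hankelH1 1 v + 2 * Complex.I / π := by
  unfold mM1
  rw [intervalIntegral.integral_eq_sub_of_hasDerivAt_of_tendsto hv
    (f := fun x : ℝ => (x:ℂ) * hankelH1 1 x) (fun x hx => ?_) (wH0_int hv.le) H1_lim
    ((H1_deriv hv).continuousAt.tendsto.mono_left nhdsWithin_le_nhds)]
  · ring
  · exact HasDerivAt.congr_deriv (H1_deriv hx.1) (mul_comm _ _)

lemma mM1_poly_int {σ : ℝ} (hσ : 0 < σ) :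
    (∫ v in (0:ℝ)..σ, mM1 v * (1 - 2 * (v:ℂ) / σ))
      = (σ * π / 2) * (hankelH1 1 σ * struveH0 σ - hankelH1 0 σ * struveH1 σ)
        - 2 * σ * hankelH1 2 σ - 8 * Complex.I / (π * σ) := by
  have hσc : (σ : ℂ) ≠ 0 := by exact_mod_cast hσ.ne'
  have hpi := pi_ne
  let f : ℝ → ℂ := fun v =>
    ((π:ℂ) / 2 * (((struveH0 v : ℝ) : ℂ) * ((v:ℂ) * hankelH1 1 v) - ((v * struveH1 v : ℝ) : ℂ) * hankelH1 0 v)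
    - (2 / (σ:ℂ)) * (2 * ((v:ℂ) * hankelH1 1 v) - ((v:ℂ) * v) * hankelH1 0 v))
    + (2 * Complex.I / π) * ((v:ℂ) - (v:ℂ) * v / σ)
  have hid : ∀ v : ℝ, HasDerivAt (fun v : ℝ => (v:ℂ)) 1 v := fun v => by
    simpa using (hasDerivAt_id v).ofReal_comp
  have hf : ∀ v : ℝ, 0 < v → HasDerivAt f (mM1 v * (1 - 2 * (v:ℂ) / σ)) v := by
    intro v hv
    have d1 := (((S0_deriv v).ofReal_comp.mul (H1_deriv hv)).sub
      ((S1_deriv v).ofReal_comp.mul (H0_deriv hv))).const_mul ((π:ℂ) / 2)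
    have d2 := (((H1_deriv hv).const_mul 2).sub
      (((hid v).mul (hid v)).mul (H0_deriv hv))).const_mul (2 / (σ:ℂ))
    have d3 := ((hid v).sub (((hid v).mul (hid v)).div_const (σ:ℂ))).const_mul (2 * Complex.I / π)
    have d := (d1.sub d2).add d3
    refine HasDerivAt.congr_deriv d ?_
    rw [mM1_eq hv]
    simp only [Pi.mul_apply]
    push_cast
    field_simp
    ring
  have l0 : Tendsto f (𝓝[>] 0) (𝓝 (8 * Complex.I / (π * σ))) := by
    have hc0 : Tendsto (fun v => ((struveH0 v : ℝ) : ℂ)) (𝓝[>] 0) (𝓝 0) := by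
      have := (S0_cont.tendsto 0).mono_left (nhdsWithin_le_nhds (s := Ioi 0))
      rw [S0_zero] at this
      simpa using ofReal_lim this
    have hc1 : Tendsto (fun v => ((struveH1 v : ℝ) : ℂ)) (𝓝[>] 0) (𝓝 (struveH1 0 : ℝ)) :=
      ofReal_lim ((S1_cont.tendsto 0).mono_left nhdsWithin_le_nhds)
    have hv : Tendsto (fun v : ℝ => (v : ℂ)) (𝓝[>] 0) (𝓝 0) := by
      have := (Complex.continuous_ofReal.tendsto 0).mono_left (nhdsWithin_le_nhds (s := Ioi 0))
      simpa using this
    have t1 := ((hc0.mul H1_lim).sub (hc1.mul H0_lim)).const_mul ((π:ℂ) / 2)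
    have t2 := ((H1_lim.const_mul 2).sub (hv.mul H0_lim)).const_mul (2 / (σ:ℂ))
    have t3 := (hv.sub ((hv.mul hv).div_const (σ:ℂ))).const_mul (2 * Complex.I / π)
    have t := (t1.sub t2).add t3
    convert t using 1
    · ext v; simp only [f]; push_cast; ring
    · congr 1; field_simp; ring
  have l1 : Tendsto f (𝓝[<] σ) (𝓝 (f σ)) := (hf σ hσ).continuousAt.tendsto.mono_left nhdsWithin_le_nhds
  rw [intervalIntegral.integral_eq_sub_of_hasDerivAt_of_tendsto hσ (fun v hv => hf v hv.1) ?_ l0 l1]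
  · simp only [f]
    have h := H2_rel hσ
    push_cast
    field_simp
    linear_combination (4 * (σ:ℂ) * π) * h
  · apply ContinuousOn.intervalIntegrable
    rw [uIcc_of_le hσ.le]
    exact (mM1_cont hσ.le).mul (by fun_prop)

lemma hk_int {k u : ℝ} (hk : 0 < k) (hu : 0 ≤ u) :
    IntervalIntegrable (fun y : ℝ => hankelH1 0 (k * |y|)) volume 0 u := by
  have h := (H0_int (σ := k * u) (by positivity)).comp_mul_left (c := k)
  rw [zero_div, mul_div_cancel_left₀ _ hk.ne'] at h
  refine h.congr ?_
  intro y hy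
  rw [uIoc_of_le hu] at hy
  simp only
  rw [abs_of_pos hy.1]

lemma hk_half {k u : ℝ} (hk : 0 < k) (hu : 0 ≤ u) (c d : ℂ) :
    (∫ y in (0:ℝ)..u, hankelH1 0 (k * |y|) * (c + d * y))
      = c * (calI0 (k * u) / k) + d * (mM1 (k * u) / k ^ 2) := by
  have hkc : (k : ℂ) ≠ 0 := by exact_mod_cast hk.ne'
  have h1 : (∫ y in (0:ℝ)..u, hankelH1 0 (k * |y|) * (c + d * y))
      = ∫ y in (0:ℝ)..u, (fun v : ℝ => c * hankelH1 0 v + (d / k) * (hankelH1 0 v * (v:ℂ))) (k * y) := by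
    refine intervalIntegral.integral_congr fun y hy => ?_
    rw [uIcc_of_le hu] at hy
    simp only
    rw [abs_of_nonneg hy.1]
    push_cast
    field_simp
  have hku : 0 ≤ k * u := by positivity
  rw [h1, intervalIntegral.integral_comp_mul_left
      (fun v : ℝ => c * hankelH1 0 v + (d / k) * (hankelH1 0 v * (v:ℂ))) hk.ne', mul_zero,
    intervalIntegral.integral_add ((H0_int hku).const_mul _) ((wH0_int hku).const_mul _),
    intervalIntegral.integral_const_mul, intervalIntegral.integral_const_mul]
  change k⁻¹ • (c * calI0 (k * u) + d / k * mM1 (k * u)) = _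
  rw [Complex.real_smul]
  push_cast
  field_simp

lemma inner_eq {k l x : ℝ} (hk : 0 < k) (hl : 0 < l) (hx : x ∈ Icc 0 l) :
    (∫ x' in (-x)..(l - x),
        hankelH1 0 (k * |x'|) * ((1 - x / l : ℝ) : ℂ) * ((1 - (x' + x) / l : ℝ) : ℂ))
    = (1 - x / l) * ((1 - x / l) * (calI0 (k * x) / k) + 1 / l * (mM1 (k * x) / k ^ 2))
      + (1 - x / l) * ((1 - x / l) * (calI0 (k * (l - x)) / k) - 1 / l * (mM1 (k * (l - x)) / k ^ 2)) := by
  have hlc : (l : ℂ) ≠ 0 := by exact_mod_cast hl.ne'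
  have hx0 := hx.1
  have hx1 : 0 ≤ l - x := by linarith [hx.2]
  have e : (fun x' : ℝ => hankelH1 0 (k * |x'|) * ((1 - x / l : ℝ) : ℂ) * ((1 - (x' + x) / l : ℝ) : ℂ))
    = fun x' : ℝ => ((1 - x / l : ℝ) : ℂ) * (hankelH1 0 (k * |x'|) * ((1 - x / l : ℂ) + (-1 / l) * x')) := by
    ext y; push_cast; ring
  have i1 : ∀ u : ℝ, 0 ≤ u → ∀ c d : ℂ,
      IntervalIntegrable (fun y : ℝ => hankelH1 0 (k * |y|) * (c + d * y)) volume 0 u :=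
    fun u hu c d => (hk_int hk hu).mul_continuousOn (by fun_prop)
  have i2 : IntervalIntegrable (fun y : ℝ => hankelH1 0 (k * |y|) * ((1 - x / l : ℂ) + (-1 / l) * y))
      volume (-x) 0 := by
    rw [IntervalIntegrable.iff_comp_neg]
    simp only [neg_neg, neg_zero, abs_neg]
    refine (i1 x hx0 (1 - x / l : ℂ) (1 / l)).symm.congr ?_
    intro y _
    simp only
    push_cast; ring
  have s2 : (∫ y in (-x)..0, hankelH1 0 (k * |y|) * ((1 - x / l : ℂ) + (-1 / l) * y))
      = ∫ y in (0:ℝ)..x, hankelH1 0 (k * |y|) * ((1 - x / l : ℂ) + (1 / l) * y) := by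
    have := intervalIntegral.integral_comp_neg (a := 0) (b := x)
      (fun y : ℝ => hankelH1 0 (k * |y|) * ((1 - x / l : ℂ) + (-1 / l) * y))
    rw [neg_zero] at this
    rw [← this]
    congr 1; ext y
    rw [abs_neg]; push_cast; ring
  rw [e, intervalIntegral.integral_const_mul,
    ← intervalIntegral.integral_add_adjacent_intervals i2 (i1 (l - x) hx1 _ _), s2,
    hk_half hk hx0, hk_half hk hx1]
  push_cast; ring

lemma double_eq {k l : ℝ} (hk : 0 < k) (hl : 0 < l) :
    (∫ x in (0:ℝ)..l, ∫ x' in (-x)..(l - x),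
        hankelH1 0 (k * |x'|) * ((1 - x / l : ℝ) : ℂ) * ((1 - (x' + x) / l : ℝ) : ℂ))
    = (1 / (k:ℂ) ^ 2) * (Gamma0 (k * l) + 2 / ((k:ℂ) * l) ^ 2 * Gamma2 (k * l)
      + 1 / ((k:ℂ) * l) * ∫ v in (0:ℝ)..(k * l), mM1 v * (1 - 2 * (v:ℂ) / (k * l : ℝ))) := by
  have hlc : (l : ℂ) ≠ 0 := by exact_mod_cast hl.ne'
  have hkc : (k : ℂ) ≠ 0 := by exact_mod_cast hk.ne'
  have hkl : 0 ≤ k * l := by positivity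
  have hcomp : ∀ {g : ℝ → ℂ}, ContinuousOn g (Icc 0 (k * l)) →
      ContinuousOn (fun x => g (k * x)) (Icc 0 l) := by
    intro g hg
    refine hg.comp (by fun_prop) ?_
    intro x hx
    exact ⟨mul_nonneg hk.le hx.1, mul_le_mul_of_nonneg_left hx.2 hk.le⟩
  have c0 := hcomp (calI0_cont hkl)
  have c1 := hcomp (mM1_cont hkl)
  have hrefl : ∀ {g : ℝ → ℂ}, ContinuousOn g (Icc 0 l) → ContinuousOn (fun x => g (l - x)) (Icc 0 l) := by
    intro g hg
    refine hg.comp (by fun_prop) ?_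
    intro x hx
    exact ⟨by linarith [hx.2], by linarith [hx.1]⟩
  have c0' := hrefl c0
  have c1' := hrefl c1
  let A : ℝ → ℂ := fun x => (1 - x / l) * ((1 - x / l) * (calI0 (k * x) / k) + 1 / l * (mM1 (k * x) / k ^ 2))
  let B : ℝ → ℂ := fun x => (x / l) * ((x / l) * (calI0 (k * x) / k) - 1 / l * (mM1 (k * x) / k ^ 2))
  have hA : ContinuousOn A (Icc 0 l) := by
    have : ContinuousOn (fun x : ℝ => (1 - (x:ℂ) / l)) (Icc 0 l) := by fun_prop
    exact this.mul ((this.mul (c0.div_const _)).add (continuousOn_const.mul (c1.div_const _)))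
  have hB : ContinuousOn B (Icc 0 l) := by
    have : ContinuousOn (fun x : ℝ => ((x:ℂ) / l)) (Icc 0 l) := by fun_prop
    exact this.mul ((this.mul (c0.div_const _)).sub (continuousOn_const.mul (c1.div_const _)))
  have iA : IntervalIntegrable A volume 0 l := by
    apply ContinuousOn.intervalIntegrable; rwa [uIcc_of_le hl.le]
  have iB : IntervalIntegrable B volume 0 l := by
    apply ContinuousOn.intervalIntegrable; rwa [uIcc_of_le hl.le]
  have iB' : IntervalIntegrable (fun x => B (l - x)) volume 0 l := by
    apply ContinuousOn.intervalIntegrable; rw [uIcc_of_le hl.le]; exact hrefl hB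
  have s1 : (∫ x in (0:ℝ)..l, ∫ x' in (-x)..(l - x),
        hankelH1 0 (k * |x'|) * ((1 - x / l : ℝ) : ℂ) * ((1 - (x' + x) / l : ℝ) : ℂ))
      = ∫ x in (0:ℝ)..l, (A x + B (l - x)) := by
    refine intervalIntegral.integral_congr fun x hx => ?_
    rw [uIcc_of_le hl.le] at hx
    rw [inner_eq hk hl hx]
    simp only [A, B]
    push_cast
    have : ((l:ℂ) - x) / l = 1 - x / l := by field_simp
    rw [this]
  have s2 : (∫ x in (0:ℝ)..l, B (l - x)) = ∫ x in (0:ℝ)..l, B x := by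
    rw [intervalIntegral.integral_comp_sub_left]; simp
  let G : ℝ → ℂ := fun v => (1 / (k:ℂ)) * ((calI0 v + 2 / ((k:ℂ) * l) ^ 2 * (((v * (v - k * l) : ℝ) : ℂ) * calI0 v))
    + 1 / ((k:ℂ) * l) * (mM1 v * (1 - 2 * (v:ℂ) / (k * l : ℝ))))
  have s3 : (∫ x in (0:ℝ)..l, (A x + B x)) = ∫ x in (0:ℝ)..l, G (k * x) := by
    congr 1; ext x
    simp only [A, B, G]
    push_cast
    field_simp
    ring
  have hu : uIcc 0 (k * l) = Icc 0 (k * l) := uIcc_of_le hkl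
  have j0 : IntervalIntegrable calI0 volume 0 (k * l) := by
    apply ContinuousOn.intervalIntegrable; rw [hu]; exact calI0_cont hkl
  have j2 : IntervalIntegrable (fun v : ℝ => ((v * (v - k * l) : ℝ) : ℂ) * calI0 v) volume 0 (k * l) := by
    apply ContinuousOn.intervalIntegrable; rw [hu]
    exact ContinuousOn.mul (by fun_prop) (calI0_cont hkl)
  have j1 : IntervalIntegrable (fun v : ℝ => mM1 v * (1 - 2 * (v:ℂ) / (k * l : ℝ))) volume 0 (k * l) := by
    apply ContinuousOn.intervalIntegrable; rw [hu]
    exact (mM1_cont hkl).mul (by fun_prop)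
  rw [s1, intervalIntegral.integral_add iA iB', s2, ← intervalIntegral.integral_add iA iB, s3,
    intervalIntegral.integral_comp_mul_left _ hk.ne', mul_zero]
  simp only [G]
  rw [intervalIntegral.integral_const_mul, intervalIntegral.integral_add (j0.add (j2.const_mul _)) (j1.const_mul _),
    intervalIntegral.integral_add j0 (j2.const_mul _), intervalIntegral.integral_const_mul,
    intervalIntegral.integral_const_mul, Complex.real_smul]
  unfold Gamma0 Gamma2
  push_cast
  ring

/-- the Galerkin single-layer self-integral with coincident-node weights. -/
theorem statement12 (k l : ℝ) (hk : 0 < k) (hl : 0 < l) :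
    (Complex.I / 4) * ∫ x in (0:ℝ)..l, ∫ x' in (-x)..(l - x),
        hankelH1 0 (k * |x'|) * ((1 - x / l : ℝ) : ℂ) * ((1 - (x' + x) / l : ℝ) : ℂ)
      = (Complex.I * (π : ℂ) / (8 * (k : ℂ) ^ 2)) *
          (hankelH1 1 (k * l) * (struveH0 (k * l) : ℂ)
            - hankelH1 0 (k * l) * (struveH1 (k * l) : ℂ))
        - (Complex.I / (2 * (k : ℂ) ^ 2)) * hankelH1 2 (k * l)
        + 2 / ((π : ℂ) * (k : ℂ) ^ 4 * (l : ℂ) ^ 2)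
        + (Complex.I / (4 * (k : ℂ) ^ 2)) * Gamma0 (k * l)
        + (Complex.I / (2 * (k : ℂ) ^ 4 * (l : ℂ) ^ 2)) * Gamma2 (k * l) := by
  have hlc : (l : ℂ) ≠ 0 := by exact_mod_cast hl.ne'
  have hkc : (k : ℂ) ≠ 0 := by exact_mod_cast hk.ne'
  have hpi := pi_ne
  rw [double_eq hk hl, mM1_poly_int (mul_pos hk hl)]
  push_cast
  field_simp
  linear_combination (-128 : ℂ) * Complex.I_sq
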